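/- arXiv:math/0408118 — 2 statements merged into one kernel-verified Lean document; each statement's English description precedes it below -/
import Mathlib

section
/- Let D_i : X_i• →^{f_i} Z_i• ←^{g_i} Y_i• (i = 1,2,3) be diagrams of cochain complexes equipped with chain maps ∪ : X₁•⊗X₂• → X₃•, ∪ : Y₁•⊗Y₂• → Y₃•, ∪ : Z₁•⊗Z₂• → Z₃• and with degree −1 maps h : X₁•⊗X₂• → Z₃• and k : Y₁•⊗Y₂• → Z₃• satisfying f₃∘∪ − ∪∘(f₁⊗f₂) = d_{Z₃}·h + h·d_{X₁⊗X₂} and g₃∘∪ − ∪∘(g₁⊗g₂) = d_{Z₃}·k + k·d_{Y₁⊗Y₂}. For each real α let ∪_α : Γ(D₁)•⊗Γ(D₂)• → Γ(D₃)• be the chain map given by (x₁,y₁,z₁) ∪_α (x₂,y₂,z₂) = ( x₁∪x₂, y₁∪y₂, (−1)^{deg x₁}((1−α)f₁(x₁) + α g₁(y₁))∪z₂ + z₁∪(α f₂(x₂) + (1−α) g₂(y₂)) − h(x₁⊗x₂) + k(y₁⊗y₂) ). Then for any two real numbers α and β, the chain maps ∪_α and ∪_β are chain homotopic. -/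
/-!
Beilinson-type products on cones of triangular diagrams of complexes
(Lemma 1 of the paper): for diagrams `D_i : X_i• →^{f_i} Z_i• ←^{g_i} Y_i•`
(`i = 1,2,3`) with compatible-up-to-homotopy cup products, the formula `∪_α`
defines a chain map `Γ(D₁)• ⊗ Γ(D₂)• → Γ(D₃)•` for every real `α`.

Conventions.  A cochain complex of `R`-modules is a family `M : ℤ → Module R`
with `d : M n →ₗ M (n+1)`, `d² = 0`.  The tensor product of complexes carries
the Koszul differential `d(a⊗b) = da⊗b + (−1)^{deg a} a⊗db`; accordingly a
*degree `j` bilinear map* `A•⊗B• → C•` is a family of bilinear maps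
`A^m ⊗ B^n → C^{m+n+j}` (recorded with a flexible target index to avoid
dependent-type casts), it is a chain map when `j = 0` and the Leibniz rule
holds, and a homotopy `s` between two such chain maps `u, v` satisfies
`u − v = d∘s + s∘d_{A⊗B}`, i.e.
`u(a,b) − v(a,b) = d(s(a,b)) + s(da,b) + (−1)^{deg a} s(a,db)`.
`Γ(D) = cone(X•⊕Y• →^{f−g} Z•)[−1]` has `Γ(D)^n = X^n ⊕ Y^n ⊕ Z^{n−1}` and
differential `d(x,y,z) = (dx, dy, f(x) − g(y) − dz)`.
-/

universe u v

/-- A cochain complex of `R`-modules indexed by `ℤ`. -/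
structure Cplx (R : Type u) [CommRing R] where
  M : ℤ → Type v
  [acg : ∀ n, AddCommGroup (M n)]
  [mod : ∀ n, Module R (M n)]
  d : ∀ n, M n →ₗ[R] M (n + 1)
  dsq : ∀ n, (d (n + 1)).comp (d n) = 0

attribute [instance] Cplx.acg Cplx.mod

variable {R : Type u} [CommRing R]

/-- The differential, with flexible target index. -/
def Cplx.D (C : Cplx R) {m n : ℤ} (h : m + 1 = n) : C.M m →ₗ[R] C.M n := by
  subst h; exact C.d m

/-- Cast along an equality of degrees. -/
def Cplx.cst (C : Cplx R) {m n : ℤ} (h : m = n) : C.M m →ₗ[R] C.M n := by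
  subst h; exact LinearMap.id

/-- A chain map of complexes. -/
structure ChMap (A B : Cplx R) where
  f : ∀ n, A.M n →ₗ[R] B.M n
  comm : ∀ (n : ℤ) (a : A.M n), B.d n (f n a) = f (n + 1) (A.d n a)

/-- Bilinear maps `A• ⊗ B• → C•` of degree `j` (families of bilinear maps
`A^m ⊗ B^n → C^{m+n+j}`, with flexible target index). -/
def Bi (A B C : Cplx R) (j : ℤ) : Type _ :=
  ∀ m n p : ℤ, m + n + j = p → (A.M m →ₗ[R] B.M n →ₗ[R] C.M p)

/-- A degree-`0` bilinear map `u : A•⊗B• → C•` is a chain map iff it satisfies the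
Leibniz rule `d(u(a,b)) = u(da,b) + (−1)^{deg a} u(a,db)` (Koszul convention). -/
def IsBiChainMap {A B C : Cplx R} (u : Bi A B C 0) : Prop :=
  ∀ (m n p p' : ℤ) (_hp : m + n = p) (hp' : p + 1 = p') (a : A.M m) (b : B.M n),
    C.D hp' (u m n p (by omega) a b)
      = u (m + 1) n p' (by omega) (A.d m a) b
        + ((m.negOnePow : ℤ)) • u m (n + 1) p' (by omega) a (B.d n b)

/-- The degree-`n` part `X^n ⊕ Y^n ⊕ Z^{n-1}` of
`Γ(D) = cone(X•⊕Y• →^{f−g} Z•)[−1]` for a diagram `D : X• →^f Z• ←^g Y•`. -/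
abbrev GM (X Y Z : Cplx R) (n : ℤ) : Type _ := X.M n × Y.M n × Z.M (n - 1)

/-- The differential `d(x,y,z) = (dx, dy, f(x) − g(y) − dz)` of `Γ(D)`. -/
def Gd {X Y Z : Cplx R} (f : ChMap X Z) (g : ChMap Y Z) (n : ℤ)
    (v : GM X Y Z n) : GM X Y Z (n + 1) :=
  (X.d n v.1, Y.d n v.2.1,
    Z.cst (by omega) (f.f n v.1 - g.f n v.2.1) - Z.D (by omega) v.2.2)

/-- Beilinson's product `∪_α` on the cones of triangular diagrams:
`(x₁,y₁,z₁) ∪_α (x₂,y₂,z₂) = (x₁∪x₂, y₁∪y₂,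
  (−1)^{deg x₁}((1−α)f₁(x₁) + α g₁(y₁))∪z₂ + z₁∪(α f₂(x₂) + (1−α) g₂(y₂))
    − h(x₁⊗x₂) + k(y₁⊗y₂))`. -/
noncomputable def cupAlpha [Algebra ℝ R]
    {X₁ Y₁ Z₁ X₂ Y₂ Z₂ X₃ Y₃ Z₃ : Cplx R}
    (f₁ : ChMap X₁ Z₁) (g₁ : ChMap Y₁ Z₁) (f₂ : ChMap X₂ Z₂) (g₂ : ChMap Y₂ Z₂)
    (cX : Bi X₁ X₂ X₃ 0) (cY : Bi Y₁ Y₂ Y₃ 0) (cZ : Bi Z₁ Z₂ Z₃ 0)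
    (h : Bi X₁ X₂ Z₃ (-1)) (k : Bi Y₁ Y₂ Z₃ (-1)) (α : ℝ)
    (m n p : ℤ) (hp : m + n = p)
    (ξ₁ : GM X₁ Y₁ Z₁ m) (ξ₂ : GM X₂ Y₂ Z₂ n) : GM X₃ Y₃ Z₃ p :=
  (cX m n p (by omega) ξ₁.1 ξ₂.1,
   cY m n p (by omega) ξ₁.2.1 ξ₂.2.1,
   ((m.negOnePow : ℤ)) •
       cZ m (n - 1) (p - 1) (by omega)
         (algebraMap ℝ R (1 - α) • f₁.f m ξ₁.1 + algebraMap ℝ R α • g₁.f m ξ₁.2.1)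
         ξ₂.2.2
     + cZ (m - 1) n (p - 1) (by omega) ξ₁.2.2
         (algebraMap ℝ R α • f₂.f n ξ₂.1 + algebraMap ℝ R (1 - α) • g₂.f n ξ₂.2.1)
     - h m n (p - 1) (by omega) ξ₁.1 ξ₂.1
     + k m n (p - 1) (by omega) ξ₁.2.1 ξ₂.2.1)

/-- The differential of `Γ(D)`, with flexible target index. -/
def GD {X Y Z : Cplx R} (f : ChMap X Z) (g : ChMap Y Z) {m n : ℤ} (h : m + 1 = n)
    (v : GM X Y Z m) : GM X Y Z n := by
  subst h; exact Gd f g m v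

theorem IsBiChainMap.D_apply {A B C : Cplx R} {u : Bi A B C 0} (hu : IsBiChainMap u)
    {m m' n n' p p' : ℤ} (hp : m + n + 0 = p) (hp' : p + 1 = p')
    (hm : m + 1 = m') (hn : n + 1 = n') (a : A.M m) (b : B.M n) :
    C.D hp' (u m n p hp a b)
      = u m' n p' (by omega) (A.D hm a) b
        + ((m.negOnePow : ℤ)) • u m n' p' (by omega) a (B.D hn b) := by
  subst hm hn
  exact hu m n p p' (by omega) hp' a b

theorem Bi.apply_cst_left {A B C : Cplx R} {j : ℤ} (u : Bi A B C j) {m m' n p : ℤ}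
    (hm : m = m') (hp : m' + n + j = p) (a : A.M m) (b : B.M n) :
    u m' n p hp (A.cst hm a) b = u m n p (by omega) a b := by
  subst hm
  rfl

theorem Bi.apply_cst_right {A B C : Cplx R} {j : ℤ} (u : Bi A B C j) {m n n' p : ℤ}
    (hn : n = n') (hp : m + n' + j = p) (a : A.M m) (b : B.M n) :
    u m n' p hp a (B.cst hn b) = u m n p (by omega) a b := by
  subst hn
  rfl

theorem GD_zero_zero {X Y Z : Cplx R} (f : ChMap X Z) (g : ChMap Y Z) {m n : ℤ}
    (h : m + 1 = n) (z : Z.M (m - 1)) :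
    GD f g h (0, 0, z) = (0, 0, -Z.D (by omega) z) := by
  subst h
  simp [GD, Gd]

/-- The bilinear map `(x₁,y₁,z₁), (x₂,y₂,z₂) ↦ (0, 0, (−1)^{deg x₁} c (z₁∪z₂))` of degree `−1`. -/
def cupZHomotopy (X₁ Y₁ X₂ Y₂ X₃ Y₃ : Cplx R) {Z₁ Z₂ Z₃ : Cplx R} (cZ : Bi Z₁ Z₂ Z₃ 0) (c : R)
    (m n p : ℤ) (hp : m + n - 1 = p) :
    GM X₁ Y₁ Z₁ m →ₗ[R] GM X₂ Y₂ Z₂ n →ₗ[R] GM X₃ Y₃ Z₃ p :=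
  (((m.negOnePow : ℤ) • c • cZ (m - 1) (n - 1) (p - 1) (by omega)).compl₁₂
    (LinearMap.snd R _ _ ∘ₗ LinearMap.snd R _ _)
    (LinearMap.snd R _ _ ∘ₗ LinearMap.snd R _ _)).compr₂
    (LinearMap.inr R _ _ ∘ₗ LinearMap.inr R _ _)

theorem cupZHomotopy_apply {X₁ Y₁ X₂ Y₂ X₃ Y₃ Z₁ Z₂ Z₃ : Cplx R} (cZ : Bi Z₁ Z₂ Z₃ 0) (c : R)
    (m n p : ℤ) (hp : m + n - 1 = p) (ξ₁ : GM X₁ Y₁ Z₁ m) (ξ₂ : GM X₂ Y₂ Z₂ n) :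
    cupZHomotopy X₁ Y₁ X₂ Y₂ X₃ Y₃ cZ c m n p hp ξ₁ ξ₂
      = (0, 0, (m.negOnePow : ℤ) •
          c • cZ (m - 1) (n - 1) (p - 1) (by omega) ξ₁.2.2 ξ₂.2.2) :=
  rfl

/-- In the situation of Lemma 1 of the paper, for any two real
numbers `α` and `β` the chain maps `∪_α, ∪_β : Γ(D₁)• ⊗ Γ(D₂)• → Γ(D₃)•` are
chain homotopic: there is a degree `−1` bilinear map
`s : Γ(D₁)•⊗Γ(D₂)• → Γ(D₃)•` with `∪_α − ∪_β = d∘s + s∘d`, i.e.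
`ξ₁ ∪_α ξ₂ − ξ₁ ∪_β ξ₂ = d(s(ξ₁,ξ₂)) + s(dξ₁,ξ₂) + (−1)^{deg ξ₁} s(ξ₁,dξ₂)`. -/
theorem cupAlpha_homotopic [Algebra ℝ R]
    (X₁ Y₁ Z₁ X₂ Y₂ Z₂ X₃ Y₃ Z₃ : Cplx R)
    (f₁ : ChMap X₁ Z₁) (g₁ : ChMap Y₁ Z₁)
    (f₂ : ChMap X₂ Z₂) (g₂ : ChMap Y₂ Z₂)
    (f₃ : ChMap X₃ Z₃) (g₃ : ChMap Y₃ Z₃)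
    (cX : Bi X₁ X₂ X₃ 0) (cY : Bi Y₁ Y₂ Y₃ 0) (cZ : Bi Z₁ Z₂ Z₃ 0)
    (hcX : IsBiChainMap cX) (hcY : IsBiChainMap cY) (hcZ : IsBiChainMap cZ)
    (h : Bi X₁ X₂ Z₃ (-1)) (k : Bi Y₁ Y₂ Z₃ (-1))
    (hh : ∀ (m n p p0 : ℤ) (_hp : m + n = p) (hp0 : p0 + 1 = p)
        (a : X₁.M m) (b : X₂.M n),
      f₃.f p (cX m n p (by omega) a b) - cZ m n p (by omega) (f₁.f m a) (f₂.f n b)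
        = Z₃.D hp0 (h m n p0 (by omega) a b)
          + h (m + 1) n p (by omega) (X₁.d m a) b
          + ((m.negOnePow : ℤ)) • h m (n + 1) p (by omega) a (X₂.d n b))
    (hk : ∀ (m n p p0 : ℤ) (_hp : m + n = p) (hp0 : p0 + 1 = p)
        (a : Y₁.M m) (b : Y₂.M n),
      g₃.f p (cY m n p (by omega) a b) - cZ m n p (by omega) (g₁.f m a) (g₂.f n b)
        = Z₃.D hp0 (k m n p0 (by omega) a b)
          + k (m + 1) n p (by omega) (Y₁.d m a) b
          + ((m.negOnePow : ℤ)) • k m (n + 1) p (by omega) a (Y₂.d n b))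
    (α β : ℝ) :
    ∃ s : ∀ m n p : ℤ, m + n - 1 = p →
        (GM X₁ Y₁ Z₁ m →ₗ[R] GM X₂ Y₂ Z₂ n →ₗ[R] GM X₃ Y₃ Z₃ p),
      ∀ (m n p p0 : ℤ) (hp : m + n = p) (hp0 : p0 + 1 = p)
        (ξ₁ : GM X₁ Y₁ Z₁ m) (ξ₂ : GM X₂ Y₂ Z₂ n),
        cupAlpha f₁ g₁ f₂ g₂ cX cY cZ h k α m n p hp ξ₁ ξ₂
          - cupAlpha f₁ g₁ f₂ g₂ cX cY cZ h k β m n p hp ξ₁ ξ₂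
          = GD f₃ g₃ hp0 (s m n p0 (by omega) ξ₁ ξ₂)
            + s (m + 1) n p (by omega) (Gd f₁ g₁ m ξ₁) ξ₂
            + ((m.negOnePow : ℤ)) • s m (n + 1) p (by omega) ξ₁ (Gd f₂ g₂ n ξ₂) := by
  refine ⟨cupZHomotopy X₁ Y₁ X₂ Y₂ X₃ Y₃ cZ (algebraMap ℝ R (α - β)), ?_⟩
  rintro m n p p0 hp hp0 ⟨x₁, y₁, z₁⟩ ⟨x₂, y₂, z₂⟩
  have leibniz := hcZ.D_apply (p := p0 - 1) (p' := p - 1) (m' := m + 1 - 1) (n' := n + 1 - 1)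
    (by omega) (by omega) (by omega) (by omega) z₁ z₂
  simp only [cupZHomotopy_apply, GD_zero_zero, cupAlpha, Gd]
  refine Prod.ext (by simp) (Prod.ext (by simp) ?_)
  simp only [Prod.snd_sub, Prod.snd_add, Prod.smul_snd, map_smul, map_zsmul, leibniz, map_sub,
    map_add, LinearMap.sub_apply, LinearMap.add_apply, LinearMap.smul_apply,
    Bi.apply_cst_left, Bi.apply_cst_right, Int.negOnePow_succ, Int.negOnePow_sub,
    Int.negOnePow_one, map_one]
  rcases Int.even_or_odd m with hm | hm
  · simp only [Int.negOnePow_even m hm, Units.val_one, Units.val_neg, Units.val_mul]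
    module
  · simp only [Int.negOnePow_odd m hm, Units.val_one, Units.val_neg, Units.val_mul]
    module
end

section
/- Let D : X• →^{f} Z• ←^{g} Y• be a diagram of cochain complexes of modules over a commutative ring, and suppose that in each degree n the map g^n : Y^n → Z^n is a split injection (it admits an R-linear retraction). Let q : Z• → (coker g)• be the degreewise quotient map and f̄ = q∘f : X• → (coker g)•. Then the complexes Γ(D) = cone(X• ⊕ Y• →^{f−g} Z•)[−1] and cone(f̄ : X• → (coker g)•)[−1] are homotopy equivalent: there exist chain maps between them whose composites in both orders are chain homotopic to the respective identities. -/
/-!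
If in a diagram `D : X• →^f Z• ←^g Y•` the map `g` is a degreewise split
injection, then `Γ(D) = cone(X•⊕Y• →^{f−g} Z•)[−1]` is homotopy equivalent to
`cone(f̄ : X• → (coker g)•)[−1]`, where `f̄ = q∘f` and `q : Z• → (coker g)•` is
the degreewise quotient map.
-/

universe u v

variable {R : Type u} [CommRing R]

/-- The degree-`n` part of the degreewise cokernel `(coker g)• = Z•/g(Y•)`. -/
abbrev Qmod {Y Z : Cplx R} (g : ChMap Y Z) (n : ℤ) :=
  Z.M n ⧸ LinearMap.range (g.f n)

/-- The differential of `(coker g)•`, induced by the differential of `Z•`. -/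
def Qd {Y Z : Cplx R} (g : ChMap Y Z) (n : ℤ) : Qmod g n →ₗ[R] Qmod g (n + 1) :=
  Submodule.mapQ _ _ (Z.d n) (by
    rintro _ ⟨y, rfl⟩
    simp only [Submodule.mem_comap]
    exact ⟨Y.d n y, (g.comm n y).symm⟩)

/-- Cast for the cokernel complex. -/
def Qcst {Y Z : Cplx R} (g : ChMap Y Z) {m n : ℤ} (h : m = n) :
    Qmod g m →ₗ[R] Qmod g n := by
  subst h; exact LinearMap.id

/-- The differential of `(coker g)•`, with flexible target index. -/
def QD {Y Z : Cplx R} (g : ChMap Y Z) {m n : ℤ} (h : m + 1 = n) :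
    Qmod g m →ₗ[R] Qmod g n := by
  subst h; exact Qd g m

/-- The degree-`n` part `X^n ⊕ (coker g)^{n−1}` of
`cone(f̄ : X• → (coker g)•)[−1]`, where `f̄ = q ∘ f`. -/
abbrev CM (X : Cplx R) {Y Z : Cplx R} (g : ChMap Y Z) (n : ℤ) : Type _ :=
  X.M n × Qmod g (n - 1)

/-- The differential `d(x, w) = (dx, f̄(x) − dw)` of `cone(f̄)[−1]`. -/
def Cd {X Y Z : Cplx R} (f : ChMap X Z) (g : ChMap Y Z) (n : ℤ)
    (w : CM X g n) : CM X g (n + 1) :=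
  (X.d n w.1,
    Qcst g (by omega) (Submodule.mkQ _ (f.f n w.1)) - QD g (by omega) w.2)

/-- The differential of `cone(f̄)[−1]`, with flexible target index. -/
def CD {X Y Z : Cplx R} (f : ChMap X Z) (g : ChMap Y Z) {m n : ℤ} (h : m + 1 = n)
    (w : CM X g m) : CM X g n := by
  subst h; exact Cd f g m w

namespace Cplx

lemma d_eq_D (C : Cplx R) (n : ℤ) (a : C.M n) : C.d n a = C.D rfl a := rfl

@[simp]
lemma cst_rfl (C : Cplx R) {n : ℤ} (h : n = n) (a : C.M n) : C.cst h a = a := rfl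

@[simp]
lemma cst_cst (C : Cplx R) {l m n : ℤ} (h : l = m) (h' : m = n) (a : C.M l) :
    C.cst h' (C.cst h a) = C.cst (h.trans h') a := by
  subst h h'; rfl

@[simp]
lemma D_cst (C : Cplx R) {l m n : ℤ} (h : l = m) (h' : m + 1 = n) (a : C.M l) :
    C.D h' (C.cst h a) = C.D (by omega) a := by
  subst h h'; rfl

@[simp]
lemma D_D (C : Cplx R) {l m n : ℤ} (h : l + 1 = m) (h' : m + 1 = n) (a : C.M l) :
    C.D h' (C.D h a) = 0 := by
  subst h h'; exact LinearMap.congr_fun (C.dsq l) a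

lemma map_cst {A B : Cplx R} (φ : ∀ n, A.M n →ₗ[R] B.M n) {m n : ℤ} (h : m = n) (a : A.M m) :
    φ n (A.cst h a) = B.cst h (φ m a) := by
  subst h; rfl

lemma map_D_eq {A B : Cplx R} (φ : ∀ n, A.M n →ₗ[R] B.M n) {m n n' : ℤ} (h : m + 1 = n)
    (h' : m + 1 = n') (a : A.M m) :
    φ n' (A.D h' a) = B.cst (h.symm.trans h') (φ n (A.D h a)) := by
  subst h h'; rfl

end Cplx

lemma ChMap.D_f {A B : Cplx R} (φ : ChMap A B) {m n : ℤ} (h : m + 1 = n) (a : A.M m) :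
    B.D h (φ.f m a) = φ.f n (A.D h a) := by
  subst h; exact φ.comm m a

section Coker

variable {X Y Z : Cplx R} (f : ChMap X Z) (g : ChMap Y Z)

@[simp]
lemma Qcst_mk {m n : ℤ} (h : m = n) (z : Z.M m) :
    Qcst g h (Submodule.Quotient.mk z) = Submodule.Quotient.mk (Z.cst h z) := by
  subst h; rfl

@[simp]
lemma QD_mk {m n : ℤ} (h : m + 1 = n) (z : Z.M m) :
    QD g h (Submodule.Quotient.mk z) = Submodule.Quotient.mk (Z.D h z) := by
  subst h; rfl

lemma Qmod_mk_g (n : ℤ) (y : Y.M n) :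
    (Submodule.Quotient.mk (g.f n y) : Qmod g n) = 0 :=
  (Submodule.Quotient.mk_eq_zero _).2 ⟨y, rfl⟩

lemma GD_eq {m n : ℤ} (h : m + 1 = n) (v : GM X Y Z m) :
    GD f g h v = (X.D h v.1, Y.D h v.2.1,
      Z.cst (by omega) (f.f m v.1 - g.f m v.2.1) - Z.D (by omega) v.2.2) := by
  subst h; rfl

lemma CD_zero {m n : ℤ} (h : m + 1 = n) : CD f g h 0 = 0 := by
  subst h; simp [CD, Cd]

/-- The projection `(x, y, z) ↦ (x, q z)` from `Γ(D)` to `cone(f̄)[−1]`. -/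
def gammaToCone (X : Cplx R) {Y Z : Cplx R} (g : ChMap Y Z) (n : ℤ) :
    GM X Y Z n →ₗ[R] CM X g n :=
  LinearMap.prodMap LinearMap.id ((Submodule.mkQ _).comp (LinearMap.snd R _ _))

@[simp]
lemma gammaToCone_apply (n : ℤ) (ξ : GM X Y Z n) :
    gammaToCone X g n ξ = (ξ.1, Submodule.Quotient.mk ξ.2.2) := rfl

variable {g} {r : ∀ n, Z.M n →ₗ[R] Y.M n} (hr : ∀ n, (r n).comp (g.f n) = LinearMap.id)

/-- The section `q z ↦ z - g (r z)` of the quotient map determined by a retraction `r` of `g`. -/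
def cokerSection (hr : ∀ n, (r n).comp (g.f n) = LinearMap.id) (n : ℤ) :
    Qmod g n →ₗ[R] Z.M n :=
  Submodule.liftQ _ (LinearMap.id - (g.f n).comp (r n)) (by
    rintro _ ⟨y, rfl⟩
    have := LinearMap.congr_fun (hr n) y
    simp only [LinearMap.comp_apply, LinearMap.id_apply] at this
    simp [LinearMap.mem_ker, this])

@[simp]
lemma cokerSection_mk (n : ℤ) (z : Z.M n) :
    cokerSection hr n (Submodule.Quotient.mk z) = z - g.f n (r n z) := rfl

/-- The map `(x, w) ↦ (x, r (f x - d (σ w)), σ w)` from `cone(f̄)[−1]` to `Γ(D)`, where `σ` is the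
section of the quotient map determined by the retraction `r` of `g`. -/
def coneToGamma (f : ChMap X Z) (hr : ∀ n, (r n).comp (g.f n) = LinearMap.id) (n : ℤ) :
    CM X g n →ₗ[R] GM X Y Z n :=
  (LinearMap.fst R _ _).prod
    (((r n).comp ((f.f n).comp (LinearMap.fst R _ _) -
      (Z.D (by omega)).comp ((cokerSection hr (n - 1)).comp (LinearMap.snd R _ _)))).prod
    ((cokerSection hr (n - 1)).comp (LinearMap.snd R _ _)))

@[simp]
lemma coneToGamma_apply (n : ℤ) (w : CM X g n) :
    coneToGamma f hr n w = (w.1, r n (f.f n w.1 - Z.D (by omega) (cokerSection hr (n - 1) w.2)),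
      cokerSection hr (n - 1) w.2) := rfl

/-- The homotopy `(x, y, z) ↦ (0, r z, 0)` on `Γ(D)`. -/
def gammaHomotopy (X : Cplx R) {Y Z : Cplx R} (r : ∀ n, Z.M n →ₗ[R] Y.M n) (m n : ℤ)
    (h : n + 1 = m) : GM X Y Z m →ₗ[R] GM X Y Z n :=
  LinearMap.prod 0 (LinearMap.prod ((Y.cst (by omega)).comp ((r (m - 1)).comp
    ((LinearMap.snd R _ _).comp (LinearMap.snd R _ _)))) 0)

@[simp]
lemma gammaHomotopy_apply (m n : ℤ) (h : n + 1 = m) (ξ : GM X Y Z m) :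
    gammaHomotopy X r m n h ξ = (0, Y.cst (by omega) (r (m - 1) ξ.2.2), 0) := rfl

lemma Cd_gammaToCone (n : ℤ) (ξ : GM X Y Z n) :
    Cd f g n (gammaToCone X g n ξ) = gammaToCone X g (n + 1) (Gd f g n ξ) := by
  obtain ⟨x, y, z⟩ := ξ
  simp [Cd, Gd, ← Cplx.map_cst g.f, Qmod_mk_g]

lemma Gd_coneToGamma (n : ℤ) (w : CM X g n) :
    Gd f g n (coneToGamma f hr n w) = coneToGamma f hr (n + 1) (Cd f g n w) := by
  obtain ⟨x, w⟩ := w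
  obtain ⟨z, rfl⟩ := Submodule.Quotient.mk_surjective _ w
  have hrg (n : ℤ) (y : Y.M n) : r n (g.f n y) = y := LinearMap.congr_fun (hr n) y
  have h₁ : n - 1 + 1 = n := by omega
  have h₂ : n - 1 + 1 = n + 1 - 1 := by omega
  simp only [Gd, Cd, coneToGamma_apply, Submodule.mkQ_apply, Qcst_mk, QD_mk, map_sub,
    cokerSection_mk, Cplx.d_eq_D, ChMap.D_f, Cplx.D_D, Cplx.D_cst, Cplx.map_cst r,
    Cplx.map_cst g.f, hrg, Cplx.map_D_eq r h₁ h₂, Cplx.map_D_eq g.f h₁ h₂, Prod.mk.injEq,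
    map_zero, true_and]
  constructor <;> abel

lemma coneToGamma_gammaToCone_sub {n n' : ℤ} (h : n' + 1 = n) (ξ : GM X Y Z n) :
    coneToGamma f hr n (gammaToCone X g n ξ) - ξ =
      GD f g h (gammaHomotopy X r n n' h ξ) +
        gammaHomotopy X r (n + 1) n rfl (Gd f g n ξ) := by
  obtain ⟨x, y, z⟩ := ξ
  have hrg (n : ℤ) (y : Y.M n) : r n (g.f n y) = y := LinearMap.congr_fun (hr n) y
  have h₁ : n - 1 + 1 = n := by omega
  have h₂ : n - 1 + 1 = n + 1 - 1 := by omega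
  simp only [GD_eq, Gd, coneToGamma_apply, gammaToCone_apply, gammaHomotopy_apply, map_sub,
    cokerSection_mk, Cplx.d_eq_D, ChMap.D_f, Cplx.D_cst, Cplx.map_cst r, Cplx.cst_cst,
    Cplx.map_cst g.f, hrg, map_zero, Prod.mk_add_mk, Prod.mk_sub_mk, Cplx.cst_rfl, Prod.mk.injEq,
    Cplx.map_D_eq r h₁ h₂]
  refine ⟨by abel, by abel, by abel⟩

lemma gammaToCone_coneToGamma (n : ℤ) (w : CM X g n) :
    gammaToCone X g n (coneToGamma f hr n w) = w := by
  obtain ⟨x, w⟩ := w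
  obtain ⟨z, rfl⟩ := Submodule.Quotient.mk_surjective _ w
  simp [Qmod_mk_g]

end Coker

/-- Let `D : X• →^f Z• ←^g Y•` be a diagram of cochain complexes
such that each `gⁿ : Yⁿ → Zⁿ` is a split injection.  Then
`Γ(D) = cone(X•⊕Y• →^{f−g} Z•)[−1]` and `cone(f̄ : X• → (coker g)•)[−1]` are
homotopy equivalent: there are chain maps between them whose composites in both
orders are chain homotopic to the respective identities. -/
theorem gamma_homotopy_equiv_cone_coker
    (X Y Z : Cplx R) (f : ChMap X Z) (g : ChMap Y Z)
    (hsplit : ∀ n, ∃ r : Z.M n →ₗ[R] Y.M n, r.comp (g.f n) = LinearMap.id) :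
    ∃ (u : ∀ n, GM X Y Z n →ₗ[R] CM X g n) (v : ∀ n, CM X g n →ₗ[R] GM X Y Z n),
      (∀ (n : ℤ) (ξ : GM X Y Z n), Cd f g n (u n ξ) = u (n + 1) (Gd f g n ξ)) ∧
      (∀ (n : ℤ) (w : CM X g n), Gd f g n (v n w) = v (n + 1) (Cd f g n w)) ∧
      (∃ s : ∀ m n : ℤ, n + 1 = m → (GM X Y Z m →ₗ[R] GM X Y Z n),
        ∀ (n n' : ℤ) (h : n' + 1 = n) (ξ : GM X Y Z n),
          v n (u n ξ) - ξ
            = GD f g h (s n n' h ξ) + s (n + 1) n (by omega) (Gd f g n ξ)) ∧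
      (∃ t : ∀ m n : ℤ, n + 1 = m → (CM X g m →ₗ[R] CM X g n),
        ∀ (n n' : ℤ) (h : n' + 1 = n) (w : CM X g n),
          u n (v n w) - w
            = CD f g h (t n n' h w) + t (n + 1) n (by omega) (Cd f g n w)) := by
  choose r hr using hsplit
  refine ⟨gammaToCone X g, coneToGamma f hr, Cd_gammaToCone f, Gd_coneToGamma f hr,
    ⟨gammaHomotopy X r, fun _ _ h ξ => coneToGamma_gammaToCone_sub f hr h ξ⟩,
    ⟨fun _ _ _ => 0, fun n n' h w => ?_⟩⟩
  simp only [gammaToCone_coneToGamma, sub_self, LinearMap.zero_apply, CD_zero, add_zero]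
end
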